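/- Fix 0 < q < 1, θ = π/4, and t ∈ ℝ. With λ_x, A_x(u), z(u) as in the elliptic parametrisation, define the amplitude ratio f_x(u) = λ_x A_{x+1}(u) z(u) / (λ_{x+1} A_x(u)) and, for u, v ∈ ℂ, R_x(u,v) = 1 + (λ_{x+1}²/λ_x²) · ( (1 − f_x(v))/f_{x−1}(u) + f_x(v) ). Then for every integer x and all u, v for which all quantities appearing are defined and denominators nonzero: R_x(u,v) = − [ θ1(2θ)² · θ4(t+2xθ) · θ4(t+2(x−1)θ) · θ4(t−(u+v)+(2x−1)θ) ] / [ θ1(θ) · θ4(t+(2x−1)θ) · θ4(t−u+(2x−1)θ) · θ4(t−v+(2x−1)θ) ] · r(u,v), where r(u,v) = θ1(u−v+θ) / (θ1(u+θ) θ1(v−θ)). In particular the x-dependent prefactor is symmetric in u and v, so the ratio R_x(v,u)/R_x(u,v) = r(v,u)/r(u,v) is independent of x and of t. -/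

import Mathlib

/-- The Jacobi theta function `θ₁(u,q) = −i Σ_{j∈ℤ} (−1)^j q^{(j+1/2)²} e^{(2j+1)iu}`. -/
noncomputable def th1 (q u : ℂ) : ℂ :=
  -Complex.I * ∑' j : ℤ, (-1 : ℂ) ^ j * q ^ (((j : ℂ) + 1 / 2) ^ 2) *
    Complex.exp ((2 * (j : ℂ) + 1) * Complex.I * u)

/-- The Jacobi theta function `θ₄(u,q) = Σ_{j∈ℤ} (−1)^j q^{j²} e^{2iju}`. -/
noncomputable def th4 (q u : ℂ) : ℂ :=
  ∑' j : ℤ, (-1 : ℂ) ^ j * q ^ ((j : ℂ) ^ 2) * Complex.exp (2 * (j : ℂ) * Complex.I * u)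

/-- `θ = π/4`. -/
noncomputable def thet : ℂ := (Real.pi : ℂ) / 4

/-- The elliptic rapidity `z(u) = −θ₁(u+θ)/θ₁(u−θ)`. -/
noncomputable def zrap (q u : ℂ) : ℂ := -th1 q (u + thet) / th1 q (u - thet)

/-- The periodic part `A_x(u) = λ_x θ₄(t−u+(2x−1)θ)/θ₄(t+(2x−1)θ)` of the Bloch wave. -/
noncomputable def Afun (q t : ℝ) (lam : ℤ → ℝ) (x : ℤ) (u : ℂ) : ℂ :=
  (lam x : ℂ) * th4 (q : ℂ) ((t : ℂ) - u + (2 * (x : ℂ) - 1) * thet) /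
    th4 (q : ℂ) ((t : ℂ) + (2 * (x : ℂ) - 1) * thet)

/-- The amplitude ratio `f_x(u) = λ_x A_{x+1}(u) z(u) / (λ_{x+1} A_x(u))`. -/
noncomputable def ffun (q t : ℝ) (lam : ℤ → ℝ) (x : ℤ) (u : ℂ) : ℂ :=
  (lam x : ℂ) * Afun q t lam (x + 1) u * zrap (q : ℂ) u /
    ((lam (x + 1) : ℂ) * Afun q t lam x u)

/-- The two-particle scattering kernel
`R_x(u,v) = 1 + (λ_{x+1}²/λ_x²)((1 − f_x(v))/f_{x−1}(u) + f_x(v))`. -/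
noncomputable def Rfun (q t : ℝ) (lam : ℤ → ℝ) (x : ℤ) (u v : ℂ) : ℂ :=
  1 + ((lam (x + 1) : ℂ) ^ 2 / (lam x : ℂ) ^ 2) *
    ((1 - ffun q t lam x v) / ffun q t lam (x - 1) u + ffun q t lam x v)

/-- `r(u,v) = θ₁(u−v+θ)/(θ₁(u+θ)θ₁(v−θ))`. -/
noncomputable def rker (q : ℝ) (u v : ℂ) : ℂ :=
  th1 (q : ℂ) (u - v + thet) / (th1 (q : ℂ) (u + thet) * th1 (q : ℂ) (v - thet))

/-- The Gaussian term `exp (L (k + s)² + 2 (k + s) i a)` of a theta series. -/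
noncomputable def gaussTerm (L : ℝ) (s a : ℂ) (k : ℤ) : ℂ :=
  Complex.exp (L * (k + s) ^ 2 + 2 * (k + s) * Complex.I * a)

/-- The theta series with Gaussian terms `gaussTerm`. -/
noncomputable def gaussThetaSum (L : ℝ) (s a : ℂ) : ℂ := ∑' k : ℤ, gaussTerm L s a k

theorem summable_gaussTerm {L : ℝ} (hL : L < 0) (s a : ℂ) : Summable (gaussTerm L s a) := by
  have hpi : (Real.pi : ℂ) ≠ 0 := by exact_mod_cast Real.pi_ne_zero
  have hτ : 0 < (-(L / Real.pi : ℝ) * Complex.I : ℂ).im := by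
    simp only [Complex.mul_im, Complex.neg_re, Complex.neg_im, Complex.ofReal_re,
      Complex.ofReal_im, Complex.I_re, Complex.I_im]
    have := div_neg_of_neg_of_pos hL Real.pi_pos
    linarith
  refine (((summable_jacobiTheta₂_term_iff ((a - s * L * Complex.I) / Real.pi) _).2 hτ).mul_left
    (Complex.exp (L * s ^ 2 + 2 * s * Complex.I * a))).congr fun k => ?_
  rw [gaussTerm, jacobiTheta₂_term, ← Complex.exp_add]
  congr 1
  push_cast
  field_simp
  linear_combination (-(2 * L * k * s) - L * (k : ℂ) ^ 2) * Complex.I_sq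

theorem neg_one_zpow_add_mul_sub (c d : ℤ) :
    (-1 : ℂ) ^ (c + d) * (-1 : ℂ) ^ (c - d) = 1 := by
  rw [← zpow_add₀ (by norm_num)]
  exact Even.neg_one_zpow ⟨c, by ring⟩

theorem neg_one_zpow_add_mul_sub_succ (c d : ℤ) :
    (-1 : ℂ) ^ (c + d + 1) * (-1 : ℂ) ^ (c - d) = -1 := by
  rw [← zpow_add₀ (by norm_num)]
  exact Odd.neg_one_zpow ⟨c, by ring⟩

/-- A summable double series over `ℤ × ℤ` splits according to the parity of the sum of the
two indices. -/
theorem tsum_int_prod_eq_add_parity {f : ℤ × ℤ → ℂ} (hf : Summable f) :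
    ∑' p, f p = ∑' p : ℤ × ℤ, f (p.1 + p.2, p.1 - p.2) +
      ∑' p : ℤ × ℤ, f (p.1 + p.2 + 1, p.1 - p.2) := by
  let i : ℤ × ℤ → ℤ × ℤ := fun p => (p.1 + p.2, p.1 - p.2)
  let j : ℤ × ℤ → ℤ × ℤ := fun p => (p.1 + p.2 + 1, p.1 - p.2)
  have hi : Function.Injective i := by
    rintro ⟨a, b⟩ ⟨c, d⟩ h
    simp only [i, Prod.mk.injEq] at h ⊢
    omega
  have hj : Function.Injective j := by
    rintro ⟨a, b⟩ ⟨c, d⟩ h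
    simp only [j, Prod.mk.injEq] at h ⊢
    omega
  have hc : IsCompl (Set.range i) (Set.range j) := by
    constructor
    · rw [Set.disjoint_left]
      rintro _ ⟨⟨a, b⟩, rfl⟩ ⟨⟨c, d⟩, h⟩
      simp only [i, j, Prod.mk.injEq] at h
      omega
    · refine codisjoint_iff.2 (Set.eq_univ_of_forall ?_)
      rintro ⟨a, b⟩
      rcases Int.even_or_odd' (a + b) with ⟨k, hk | hk⟩
      · exact Or.inl ⟨(k, k - b), by simp only [i, Prod.mk.injEq]; omega⟩
      · exact Or.inr ⟨(k, k - b), by simp only [j, Prod.mk.injEq]; omega⟩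
  exact (HasSum.add_isCompl hc (hi.hasSum_range_iff.2 (hf.comp_injective hi).hasSum)
    (hj.hasSum_range_iff.2 (hf.comp_injective hj).hasSum)).tsum_eq

theorem gaussThetaSum_mul_gaussThetaSum {L : ℝ} (hL : L < 0) (s r a b : ℂ) :
    gaussThetaSum L s a * gaussThetaSum L r b = ∑' p : ℤ × ℤ, gaussTerm L s a p.1 * gaussTerm L r b p.2 :=
  tsum_mul_tsum_of_summable_norm (summable_gaussTerm hL s a).norm (summable_gaussTerm hL r b).norm

theorem summable_norm_alternating_gaussTerm {L : ℝ} (hL : L < 0) (s a : ℂ) :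
    Summable fun k : ℤ => ‖(-1 : ℂ) ^ k * gaussTerm L s a k‖ := by
  simpa using (summable_gaussTerm hL s a).norm

theorem th4_eq_tsum {q : ℝ} (hq : 0 < q) (u : ℂ) :
    th4 q u = ∑' k : ℤ, (-1 : ℂ) ^ k * gaussTerm (Real.log q) 0 u k := by
  refine tsum_congr fun k => ?_
  rw [gaussTerm, Complex.cpow_def_of_ne_zero (by exact_mod_cast hq.ne'), mul_assoc,
    ← Complex.exp_add, Complex.ofReal_log hq.le]
  ring_nf

theorem th1_eq_tsum {q : ℝ} (hq : 0 < q) (u : ℂ) :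
    th1 q u = -Complex.I * ∑' k : ℤ, (-1 : ℂ) ^ k * gaussTerm (Real.log q) (1 / 2) u k := by
  refine congrArg _ (tsum_congr fun k => ?_)
  rw [gaussTerm, Complex.cpow_def_of_ne_zero (by exact_mod_cast hq.ne'), mul_assoc,
    ← Complex.exp_add, Complex.ofReal_log hq.le]
  ring_nf

theorem th4_add_mul_th4_sub {q : ℝ} (hq : 0 < q) (hq1 : q < 1) (a b : ℂ) :
    th4 q (a + b) * th4 q (a - b) =
      gaussThetaSum (2 * Real.log q) 0 (2 * a) * gaussThetaSum (2 * Real.log q) 0 (2 * b) -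
      gaussThetaSum (2 * Real.log q) (1 / 2) (2 * a) * gaussThetaSum (2 * Real.log q) (1 / 2) (2 * b) := by
  have hL : Real.log q < 0 := Real.log_neg hq hq1
  have hL2 : 2 * Real.log q < 0 := by linarith
  have h1 := summable_norm_alternating_gaussTerm hL 0 (a + b)
  have h2 := summable_norm_alternating_gaussTerm hL 0 (a - b)
  rw [th4_eq_tsum hq, th4_eq_tsum hq, tsum_mul_tsum_of_summable_norm h1 h2,
    tsum_int_prod_eq_add_parity (summable_mul_of_summable_norm h1 h2), sub_eq_add_neg (_ * _),
    gaussThetaSum_mul_gaussThetaSum hL2, gaussThetaSum_mul_gaussThetaSum hL2, ← tsum_neg]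
  congr 1 <;> refine tsum_congr fun p => ?_ <;> rw [mul_mul_mul_comm]
  · rw [neg_one_zpow_add_mul_sub, one_mul]
    simp only [gaussTerm, ← Complex.exp_add]
    congr 1
    push_cast
    ring
  · rw [neg_one_zpow_add_mul_sub_succ, neg_one_mul]
    simp only [gaussTerm, ← Complex.exp_add]
    congr 2
    push_cast
    ring

theorem th1_add_mul_th1_sub {q : ℝ} (hq : 0 < q) (hq1 : q < 1) (a b : ℂ) :
    th1 q (a + b) * th1 q (a - b) =
      gaussThetaSum (2 * Real.log q) 0 (2 * a) * gaussThetaSum (2 * Real.log q) (1 / 2) (2 * b) -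
      gaussThetaSum (2 * Real.log q) (1 / 2) (2 * a) * gaussThetaSum (2 * Real.log q) 0 (2 * b) := by
  have hL : Real.log q < 0 := Real.log_neg hq hq1
  have hL2 : 2 * Real.log q < 0 := by linarith
  have h1 := summable_norm_alternating_gaussTerm hL (1 / 2) (a + b)
  have h2 := summable_norm_alternating_gaussTerm hL (1 / 2) (a - b)
  have key : (∑' k : ℤ, (-1 : ℂ) ^ k * gaussTerm (Real.log q) (1 / 2) (a + b) k) *
      ∑' k : ℤ, (-1 : ℂ) ^ k * gaussTerm (Real.log q) (1 / 2) (a - b) k =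
      gaussThetaSum (2 * Real.log q) (1 / 2) (2 * a) * gaussThetaSum (2 * Real.log q) 0 (2 * b) -
      gaussThetaSum (2 * Real.log q) 0 (2 * a) * gaussThetaSum (2 * Real.log q) (1 / 2) (2 * b) := by
    rw [tsum_mul_tsum_of_summable_norm h1 h2,
      tsum_int_prod_eq_add_parity (summable_mul_of_summable_norm h1 h2), sub_eq_add_neg (_ * _),
      gaussThetaSum_mul_gaussThetaSum hL2, gaussThetaSum_mul_gaussThetaSum hL2, ← tsum_neg,
      ← (Equiv.addRight ((1 : ℤ), (0 : ℤ))).tsum_eq fun p : ℤ × ℤ =>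
        -(gaussTerm (2 * Real.log q) 0 (2 * a) p.1 *
          gaussTerm (2 * Real.log q) (1 / 2) (2 * b) p.2)]
    congr 1 <;> refine tsum_congr fun p => ?_ <;> rw [mul_mul_mul_comm]
    · rw [neg_one_zpow_add_mul_sub, one_mul]
      simp only [gaussTerm, ← Complex.exp_add]
      congr 1
      push_cast
      ring
    · rw [neg_one_zpow_add_mul_sub_succ, neg_one_mul]
      simp only [gaussTerm, ← Complex.exp_add, Equiv.coe_addRight, Prod.fst_add, Prod.snd_add]
      congr 2
      push_cast
      ring
  rw [th1_eq_tsum hq, th1_eq_tsum hq, mul_mul_mul_comm, key]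
  linear_combination (gaussThetaSum (2 * Real.log q) (1 / 2) (2 * a) *
    gaussThetaSum (2 * Real.log q) 0 (2 * b) - gaussThetaSum (2 * Real.log q) 0 (2 * a) *
    gaussThetaSum (2 * Real.log q) (1 / 2) (2 * b)) * Complex.I_sq

/-- The three-term Weierstrass relation for `θ₄` and `θ₁`. -/
theorem th4_th1_weierstrass {q : ℝ} (hq : 0 < q) (hq1 : q < 1) (a b c d : ℂ) :
    th4 q (a + b) * th4 q (a - b) * (th1 q (c + d) * th1 q (c - d)) -
      th4 q (a + c) * th4 q (a - c) * (th1 q (b + d) * th1 q (b - d)) +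
      th4 q (a + d) * th4 q (a - d) * (th1 q (b + c) * th1 q (b - c)) = 0 := by
  simp only [th4_add_mul_th4_sub hq hq1, th1_add_mul_th1_sub hq hq1]
  ring

theorem th1_neg {q : ℝ} (hq : 0 < q) (u : ℂ) : th1 q (-u) = -th1 q u := by
  rw [th1_eq_tsum hq, th1_eq_tsum hq, ← mul_neg, ← tsum_neg,
    ← (Equiv.subLeft (-1 : ℤ)).tsum_eq]
  refine congrArg _ (tsum_congr fun k => ?_)
  have h : (-1 : ℂ) ^ (-1 - k) = -(-1 : ℂ) ^ k := by
    rw [zpow_sub₀ (by norm_num)]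
    rcases Int.even_or_odd k with hk | hk <;> simp [hk.neg_one_zpow]
  rw [Equiv.subLeft_apply, h, neg_mul]
  simp only [gaussTerm]
  congr 3
  push_cast
  ring

theorem exp_two_pi_mul_int (k : ℤ) : Complex.exp (2 * k * Complex.I * Real.pi) = 1 :=
  Complex.exp_eq_one_iff.2 ⟨k, by ring⟩

theorem th4_add_pi {q : ℝ} (hq : 0 < q) (u : ℂ) : th4 q (u + Real.pi) = th4 q u := by
  rw [th4_eq_tsum hq, th4_eq_tsum hq]
  refine tsum_congr fun k => congrArg _ ?_
  rw [gaussTerm, gaussTerm, ← mul_one (Complex.exp (_ + _ * u)), ← exp_two_pi_mul_int k,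
    ← Complex.exp_add]
  ring_nf

theorem th1_add_pi {q : ℝ} (hq : 0 < q) (u : ℂ) : th1 q (u + Real.pi) = -th1 q u := by
  rw [th1_eq_tsum hq, th1_eq_tsum hq, ← mul_neg, ← tsum_neg]
  refine congrArg _ (tsum_congr fun k => ?_)
  have h : gaussTerm (Real.log q) (1 / 2) (u + Real.pi) k =
      gaussTerm (Real.log q) (1 / 2) u k * Complex.exp (2 * k * Complex.I * Real.pi) *
        Complex.exp (Real.pi * Complex.I) := by
    simp only [gaussTerm, ← Complex.exp_add]
    ring_nf
  rw [h, exp_two_pi_mul_int, Complex.exp_pi_mul_I]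
  ring

theorem th4_congr_pi {q : ℝ} (hq : 0 < q) {u v : ℂ} (h : u = v + 4 * thet) :
    th4 q u = th4 q v := by
  rw [h, ← th4_add_pi hq v, thet]
  ring_nf

theorem th1_congr_pi {q : ℝ} (hq : 0 < q) {u v : ℂ} (h : u = v + 4 * thet) :
    th1 q u = -th1 q v := by
  rw [h, ← th1_add_pi hq v, thet]
  ring_nf

theorem th4_kernel_sub {q : ℝ} (hq : 0 < q) (hq1 : q < 1) (s u : ℂ) :
    th1 q thet * (th4 q s * th4 q (s - u) * th1 q (u + thet) -
      th4 q (s + 2 * thet) * th4 q (s - u + 2 * thet) * th1 q (u - thet)) =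
    -(th4 q (s - thet) * th4 q (s - u + thet) * th1 q (u - 2 * thet) * th1 q (2 * thet)) := by
  have h := th4_th1_weierstrass hq hq1 (s - u / 2) (u / 2) (u / 2 - 2 * thet) (u / 2 - thet)
  rw [show s - u / 2 + u / 2 = s by ring, show s - u / 2 - u / 2 = s - u by ring,
    show u / 2 - 2 * thet + (u / 2 - thet) = u - 3 * thet by ring,
    show u / 2 - 2 * thet - (u / 2 - thet) = -thet by ring,
    show s - u / 2 + (u / 2 - 2 * thet) = s - 2 * thet by ring,
    show s - u / 2 - (u / 2 - 2 * thet) = s - u + 2 * thet by ring,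
    show u / 2 + (u / 2 - thet) = u - thet by ring,
    show u / 2 - (u / 2 - thet) = thet by ring,
    show s - u / 2 + (u / 2 - thet) = s - thet by ring,
    show s - u / 2 - (u / 2 - thet) = s - u + thet by ring,
    show u / 2 + (u / 2 - 2 * thet) = u - 2 * thet by ring,
    show u / 2 - (u / 2 - 2 * thet) = 2 * thet by ring, th1_neg hq] at h
  rw [th4_congr_pi hq (show s + 2 * thet = s - 2 * thet + 4 * thet by ring),
    th1_congr_pi hq (show u + thet = u - 3 * thet + 4 * thet by ring)]
  linear_combination h

theorem th4_kernel_add {q : ℝ} (hq : 0 < q) (hq1 : q < 1) (s u : ℂ) :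
    th1 q thet * (th4 q s * th4 q (s - u + 2 * thet) * th1 q (u - thet) +
      th4 q (s + 2 * thet) * th4 q (s - u) * th1 q (u + thet)) =
    th4 q (s - thet) * th4 q (s - u - thet) * th1 q u * th1 q (2 * thet) := by
  have h := th4_th1_weierstrass hq hq1 (s - thet - u / 2) (u / 2 + thet) (u / 2 - thet) (u / 2)
  rw [show s - thet - u / 2 + (u / 2 + thet) = s by ring,
    show s - thet - u / 2 - (u / 2 + thet) = s - u - 2 * thet by ring,
    show u / 2 - thet + u / 2 = u - thet by ring,
    show u / 2 - thet - u / 2 = -thet by ring,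
    show s - thet - u / 2 + (u / 2 - thet) = s - 2 * thet by ring,
    show s - thet - u / 2 - (u / 2 - thet) = s - u by ring,
    show u / 2 + thet + u / 2 = u + thet by ring,
    show u / 2 + thet - u / 2 = thet by ring,
    show s - thet - u / 2 + u / 2 = s - thet by ring,
    show s - thet - u / 2 - u / 2 = s - u - thet by ring,
    show u / 2 + thet + (u / 2 - thet) = u by ring,
    show u / 2 + thet - (u / 2 - thet) = 2 * thet by ring, th1_neg hq] at h
  rw [th4_congr_pi hq (show s + 2 * thet = s - 2 * thet + 4 * thet by ring),
    th4_congr_pi hq (show s - u + 2 * thet = s - u - 2 * thet + 4 * thet by ring)]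
  linear_combination -h

theorem th4_kernel_combine {q : ℝ} (hq : 0 < q) (hq1 : q < 1) (s u v : ℂ) :
    th4 q (s - v) * th4 q (s - u + thet) * th1 q (u - 2 * thet) * th1 q (v - thet) +
      th4 q (s - v + 2 * thet) * th4 q (s - u - thet) * th1 q u * th1 q (v + thet) =
    th4 q (s + thet) * th4 q (s - (u + v)) * th1 q (u - v + thet) * th1 q (2 * thet) := by
  have h := th4_th1_weierstrass hq hq1 (s + (thet - u - v) / 2) ((u - v - thet) / 2)
    ((u - v + 3 * thet) / 2) ((u + v + thet) / 2)
  rw [show s + (thet - u - v) / 2 + (u - v - thet) / 2 = s - v by ring,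
    show s + (thet - u - v) / 2 - (u - v - thet) / 2 = s - u + thet by ring,
    show (u - v + 3 * thet) / 2 + (u + v + thet) / 2 = u + 2 * thet by ring,
    show (u - v + 3 * thet) / 2 - (u + v + thet) / 2 = -(v - thet) by ring,
    show s + (thet - u - v) / 2 + (u - v + 3 * thet) / 2 = s - v + 2 * thet by ring,
    show s + (thet - u - v) / 2 - (u - v + 3 * thet) / 2 = s - u - thet by ring,
    show (u - v - thet) / 2 + (u + v + thet) / 2 = u by ring,
    show (u - v - thet) / 2 - (u + v + thet) / 2 = -(v + thet) by ring,
    show s + (thet - u - v) / 2 + (u + v + thet) / 2 = s + thet by ring,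
    show s + (thet - u - v) / 2 - (u + v + thet) / 2 = s - (u + v) by ring,
    show (u - v - thet) / 2 + (u - v + 3 * thet) / 2 = u - v + thet by ring,
    show (u - v - thet) / 2 - (u - v + 3 * thet) / 2 = -(2 * thet) by ring,
    th1_neg hq, th1_neg hq, th1_neg hq,
    th1_congr_pi hq (show u + 2 * thet = u - 2 * thet + 4 * thet by ring)] at h
  linear_combination h

/-- The two-particle kernel with all denominators cleared. -/
theorem th4_kernel_factorisation {q : ℝ} (hq : 0 < q) (hq1 : q < 1) (s u v : ℂ) :
    th1 q thet *
      (th4 q s * th4 q (s - u) * th4 q (s - v) * th1 q (u + thet) * th1 q (v - thet) -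
        th4 q (s + 2 * thet) * th4 q (s - u + 2 * thet) * th4 q (s - v) *
          th1 q (u - thet) * th1 q (v - thet) -
        th4 q s * th4 q (s - u + 2 * thet) * th4 q (s - v + 2 * thet) *
          th1 q (u - thet) * th1 q (v + thet) -
        th4 q (s + 2 * thet) * th4 q (s - u) * th4 q (s - v + 2 * thet) *
          th1 q (u + thet) * th1 q (v + thet)) =
    -(th1 q (2 * thet) ^ 2 * th4 q (s + thet) * th4 q (s - thet) * th4 q (s - (u + v)) *
      th1 q (u - v + thet)) := by
  linear_combination th1 q (v - thet) * th4 q (s - v) * th4_kernel_sub hq hq1 s u -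
    th1 q (v + thet) * th4 q (s - v + 2 * thet) * th4_kernel_add hq hq1 s u -
    th4 q (s - thet) * th1 q (2 * thet) * th4_kernel_combine hq hq1 s u v

theorem ffun_eq (q t : ℝ) {lam : ℤ → ℝ} (hlam : ∀ x, 0 < lam x) (x : ℤ) (u : ℂ) :
    ffun q t lam x u =
      th4 q (t - u + (2 * (x : ℂ) + 1) * thet) * th4 q (t + (2 * (x : ℂ) - 1) * thet) *
        zrap q u /
      (th4 q (t + (2 * (x : ℂ) + 1) * thet) * th4 q (t - u + (2 * (x : ℂ) - 1) * thet)) := by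
  have h0 : (lam x : ℂ) ≠ 0 := by exact_mod_cast (hlam x).ne'
  have h1 : (lam (x + 1) : ℂ) ≠ 0 := by exact_mod_cast (hlam (x + 1)).ne'
  rw [ffun, Afun, Afun, show 2 * ((x + 1 : ℤ) : ℂ) - 1 = 2 * x + 1 by push_cast; ring]
  field_simp

/-- factorisation of the two-particle kernel `R_x(u,v)` into an
`(u,v)`-symmetric, `x`-dependent prefactor times the reduced kernel `r(u,v)`. -/
theorem stmt9 (q t : ℝ) (hq : 0 < q) (hq1 : q < 1)
    (lam mu : ℤ → ℝ) (hlampos : ∀ x, 0 < lam x) (hmupos : ∀ x, 0 < mu x)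
    (hlam : ∀ x : ℤ, ((lam x : ℂ)) ^ 2 =
      2 * (th1 (q : ℂ) thet / th1 (q : ℂ) (2 * thet)) ^ 2 *
        th4 (q : ℂ) ((t : ℂ) + (2 * (x : ℂ) - 1) * thet) ^ 2 /
        (th4 (q : ℂ) ((t : ℂ) + 2 * ((x : ℂ) - 1) * thet) *
          th4 (q : ℂ) ((t : ℂ) + 2 * (x : ℂ) * thet)))
    (hmu : ∀ x : ℤ, ((mu x : ℂ)) ^ 2 =
      (th1 (q : ℂ) thet / th1 (q : ℂ) (2 * thet)) ^ 2 *
        th4 (q : ℂ) ((t : ℂ) + 2 * (x : ℂ) * thet) ^ 2 /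
        (th4 (q : ℂ) ((t : ℂ) + (2 * (x : ℂ) - 1) * thet) *
          th4 (q : ℂ) ((t : ℂ) + (2 * (x : ℂ) + 1) * thet)))
    (x : ℤ) (u v : ℂ)
    (hu1 : th1 (q : ℂ) (u - thet) ≠ 0) (hu2 : th1 (q : ℂ) (u + thet) ≠ 0)
    (hv1 : th1 (q : ℂ) (v - thet) ≠ 0) (hv2 : th1 (q : ℂ) (v + thet) ≠ 0)
    (ht1 : th1 (q : ℂ) thet ≠ 0) (ht2 : th1 (q : ℂ) (2 * thet) ≠ 0)
    (h4u : th4 (q : ℂ) ((t : ℂ) - u + (2 * (x : ℂ) - 1) * thet) ≠ 0)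
    (h4u' : th4 (q : ℂ) ((t : ℂ) - u + (2 * (x : ℂ) - 3) * thet) ≠ 0)
    (h4v : th4 (q : ℂ) ((t : ℂ) - v + (2 * (x : ℂ) - 1) * thet) ≠ 0)
    (h4a : th4 (q : ℂ) ((t : ℂ) + (2 * (x : ℂ) - 1) * thet) ≠ 0)
    (h4b : th4 (q : ℂ) ((t : ℂ) + (2 * (x : ℂ) - 3) * thet) ≠ 0)
    (h4c : th4 (q : ℂ) ((t : ℂ) + (2 * (x : ℂ) + 1) * thet) ≠ 0)
    (h4d : th4 (q : ℂ) ((t : ℂ) + 2 * (x : ℂ) * thet) ≠ 0)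
    (h4e : th4 (q : ℂ) ((t : ℂ) + 2 * ((x : ℂ) - 1) * thet) ≠ 0) :
    Rfun q t lam x u v =
      -(th1 (q : ℂ) (2 * thet) ^ 2 * th4 (q : ℂ) ((t : ℂ) + 2 * (x : ℂ) * thet) *
          th4 (q : ℂ) ((t : ℂ) + 2 * ((x : ℂ) - 1) * thet) *
          th4 (q : ℂ) ((t : ℂ) - (u + v) + (2 * (x : ℂ) - 1) * thet)) /
        (th1 (q : ℂ) thet * th4 (q : ℂ) ((t : ℂ) + (2 * (x : ℂ) - 1) * thet) *
          th4 (q : ℂ) ((t : ℂ) - u + (2 * (x : ℂ) - 1) * thet) *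
          th4 (q : ℂ) ((t : ℂ) - v + (2 * (x : ℂ) - 1) * thet)) * rker q u v := by
  obtain ⟨s, hs⟩ : ∃ s : ℂ, s = t + (2 * (x : ℂ) - 1) * thet := ⟨_, rfl⟩
  have e2 : (t : ℂ) + 2 * (x : ℂ) * thet = s + thet := by rw [hs]; ring
  have e3 : (t : ℂ) + 2 * ((x : ℂ) - 1) * thet = s - thet := by rw [hs]; ring
  have e4 (w : ℂ) : (t : ℂ) - w + (2 * (x : ℂ) - 1) * thet = s - w := by rw [hs]; ring
  have e5 : (t : ℂ) + (2 * (x : ℂ) + 1) * thet = s + 2 * thet := by rw [hs]; ring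
  have e6 (w : ℂ) : (t : ℂ) - w + (2 * (x : ℂ) + 1) * thet = s - w + 2 * thet := by rw [hs]; ring
  have p7 : th4 q (t + (2 * (x : ℂ) - 3) * thet) = th4 q (s + 2 * thet) :=
    (th4_congr_pi hq (by rw [hs]; ring)).symm
  have p8 (w : ℂ) : th4 q (t - w + (2 * (x : ℂ) - 3) * thet) = th4 q (s - w + 2 * thet) :=
    (th4_congr_pi hq (by rw [hs]; ring)).symm
  have fx : ffun q t lam x v = th4 q (s - v + 2 * thet) * th4 q s * zrap q v /
      (th4 q (s + 2 * thet) * th4 q (s - v)) := by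
    rw [ffun_eq q t hlampos, e4, e5, e6, ← hs]
  have fx' : ffun q t lam (x - 1) u = th4 q (s - u) * th4 q (s + 2 * thet) * zrap q u /
      (th4 q s * th4 q (s - u + 2 * thet)) := by
    rw [ffun_eq q t hlampos, show 2 * ((x - 1 : ℤ) : ℂ) + 1 = 2 * x - 1 by push_cast; ring,
      show 2 * ((x - 1 : ℤ) : ℂ) - 1 = 2 * x - 3 by push_cast; ring, e4, p7, p8, ← hs]
  have hl0 := hlam x
  have hl1 := hlam (x + 1)
  rw [show (t : ℂ) + 2 * (((x + 1 : ℤ) : ℂ) - 1) * thet = s + thet by rw [hs]; push_cast; ring,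
    show (t : ℂ) + (2 * ((x + 1 : ℤ) : ℂ) - 1) * thet = s + 2 * thet by rw [hs]; push_cast; ring,
    th4_congr_pi hq (show (t : ℂ) + 2 * ((x + 1 : ℤ) : ℂ) * thet = s - thet + 4 * thet by
      rw [hs]; push_cast; ring)] at hl1
  rw [e4] at h4u h4v
  rw [e5] at h4c
  rw [← hs] at h4a hl0
  rw [e2] at h4d hl0
  rw [e3] at h4e hl0
  rw [Rfun, fx, fx', hl0, hl1, e2, e3, e4, e4, e4, ← hs, zrap, zrap, rker]
  have key := th4_kernel_factorisation hq hq1 s u v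
  generalize th4 (q : ℂ) (s - (u + v)) = Tuv at *
  generalize th1 (q : ℂ) (u - v + thet) = Suv at *
  generalize th4 (q : ℂ) (s + thet) = Tp at *
  generalize th4 (q : ℂ) (s - thet) = Tm at *
  generalize th4 (q : ℂ) (s + 2 * thet) = T' at *
  generalize th4 (q : ℂ) (s - u + 2 * thet) = Tu' at *
  generalize th4 (q : ℂ) (s - v + 2 * thet) = Tv' at *
  generalize th4 (q : ℂ) (s - u) = Tu at *
  generalize th4 (q : ℂ) (s - v) = Tv at *
  generalize th4 (q : ℂ) s = T at *
  generalize th1 (q : ℂ) (u + thet) = Sup at *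
  generalize th1 (q : ℂ) (u - thet) = Sum at *
  generalize th1 (q : ℂ) (v + thet) = Svp at *
  generalize th1 (q : ℂ) (v - thet) = Svm at *
  generalize th1 (q : ℂ) (2 * thet) = S2 at *
  generalize th1 (q : ℂ) thet = S1 at *
  field_simp
  linear_combination key
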